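/- Every edge of the circulant graph C_{21}(1,6) has edge betweenness centrality equal to 22; hence C_{21}(1,6) is edge-betweenness-uniform. -/

import Mathlib

open SimpleGraph Finset

/-- The number of shortest paths between `x` and `y` in `G`. -/
noncomputable def numShortestPaths {V : Type*} (G : SimpleGraph V) (x y : V) : ℕ :=
  Nat.card {p : G.Walk x y // p.length = G.dist x y}

/-- The number of shortest paths between `x` and `y` in `G` that contain the edge `e`. -/
noncomputable def numShortestPathsThru {V : Type*} (G : SimpleGraph V) (x y : V)
    (e : Sym2 V) : ℕ :=
  Nat.card {p : G.Walk x y // p.length = G.dist x y ∧ e ∈ p.edges}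

open Classical in
/-- The edge betweenness centrality of `e`: the sum over ordered pairs of distinct
vertices `(x, y)` of the fraction of shortest `x`-`y` paths containing `e`. -/
noncomputable def edgeBetweenness {V : Type*} [Fintype V] (G : SimpleGraph V)
    (e : Sym2 V) : ℚ :=
  ∑ x : V, ∑ y : V, if x = y then 0 else
    (numShortestPathsThru G x y e : ℚ) / (numShortestPaths G x y)

/-- The graph under study. -/
abbrev GG : SimpleGraph (ZMod 21) := circulantGraph ({1, -1, 6, -6} : Set (ZMod 21))

/-- Number of walks of length `n` from `x` to `y` avoiding the pair `{0, s}`. -/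
def cnt (s : ZMod 21) : ℕ → ZMod 21 → ZMod 21 → ℕ
  | 0, x, y => if x = y then 1 else 0
  | n + 1, x, y =>
    (if (x = 0 ∧ x + 1 = s) ∨ (x = s ∧ x + 1 = 0) then 0 else cnt s n (x + 1) y) +
    ((if (x = 0 ∧ x + 20 = s) ∨ (x = s ∧ x + 20 = 0) then 0 else cnt s n (x + 20) y) +
    ((if (x = 0 ∧ x + 6 = s) ∨ (x = s ∧ x + 6 = 0) then 0 else cnt s n (x + 6) y) +
    (if (x = 0 ∧ x + 15 = s) ∨ (x = s ∧ x + 15 = 0) then 0 else cnt s n (x + 15) y)))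

/-- The explicit distance function. -/
def dd (z : ZMod 21) : ℕ :=
  if cnt 0 0 0 z ≠ 0 then 0 else if cnt 0 1 0 z ≠ 0 then 1 else if cnt 0 2 0 z ≠ 0 then 2 else 3

lemma gg_adj (x w : ZMod 21) :
    GG.Adj x w ↔ w ∈ ({x + 1, x + 20, x + 6, x + 15} : Finset (ZMod 21)) := by
  simp only [GG, circulantGraph_adj, Set.mem_insert_iff, Set.mem_singleton_iff]
  revert x w
  decide +kernel

instance : DecidableRel GG.Adj := fun x w => decidable_of_iff _ (gg_adj x w).symm

instance (n : ℕ) (x y : ZMod 21) : Finite {p : GG.Walk x y // p.length = n} := by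
  classical
  exact Finite.of_fintype {p : GG.Walk x y // p.length = n}

instance (n : ℕ) (x y : ZMod 21) (e : Sym2 (ZMod 21)) :
    Finite {p : GG.Walk x y // p.length = n ∧ e ∉ p.edges} :=
  Set.Finite.subset (s := {p : GG.Walk x y | p.length = n})
    (inferInstanceAs (Finite {p : GG.Walk x y // p.length = n})) (fun _ h => h.1)

instance (n : ℕ) (x y : ZMod 21) (e : Sym2 (ZMod 21)) :
    Finite {p : GG.Walk x y // p.length = n ∧ e ∈ p.edges} :=
  Set.Finite.subset (s := {p : GG.Walk x y | p.length = n})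
    (inferInstanceAs (Finite {p : GG.Walk x y // p.length = n})) (fun _ h => h.1)

/-- First-step decomposition. -/
def stepFun (n : ℕ) (x y : ZMod 21) (e : Sym2 (ZMod 21))
    (q : Σ w : {w : ZMod 21 // GG.Adj x w ∧ e ≠ s(x, w)},
      {p : GG.Walk w.1 y // p.length = n ∧ e ∉ p.edges}) :
    {p : GG.Walk x y // p.length = n + 1 ∧ e ∉ p.edges} :=
  ⟨.cons q.1.2.1 q.2.1, by simp [q.2.2.1], by
    have h1 := q.1.2.2
    have h2 := q.2.2.2
    simp only [Walk.edges_cons, List.mem_cons, not_or]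
    exact ⟨h1, h2⟩⟩

lemma stepFun_bij (n : ℕ) (x y : ZMod 21) (e : Sym2 (ZMod 21)) :
    Function.Bijective (stepFun n x y e) := by
  constructor
  · rintro ⟨⟨w, hw⟩, ⟨p, hp⟩⟩ ⟨⟨w', hw'⟩, ⟨p', hp'⟩⟩ h
    simp only [stepFun, Subtype.mk.injEq, Walk.cons.injEq] at h
    obtain ⟨rfl, h⟩ := h
    obtain rfl := eq_of_heq h
    rfl
  · rintro ⟨p, hp⟩
    cases p with
    | nil => exact absurd hp.1 (by simp)
    | cons h p =>
      exact ⟨⟨⟨_, h, fun H => hp.2 (by simp [H])⟩,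
        ⟨p, by simpa using hp.1, fun H => hp.2 (by simp [H])⟩⟩, rfl⟩

lemma card_avoid (a s : ZMod 21) (n : ℕ) (x y : ZMod 21) :
    Nat.card {p : GG.Walk x y // p.length = n ∧ s(a, a + s) ∉ p.edges} =
      cnt s n (x - a) (y - a) := by
  induction n generalizing x with
  | zero =>
    simp only [cnt, sub_left_inj]
    split_ifs with h
    · subst h
      rw [Nat.card_eq_one_iff_unique]
      refine ⟨⟨?_⟩, ⟨⟨.nil, by simp⟩⟩⟩
      rintro ⟨p, hp⟩ ⟨q, hq⟩
      have h1 := Walk.nil_iff_eq_nil.1 (Walk.length_eq_zero_iff.1 hp.1)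
      have h2 := Walk.nil_iff_eq_nil.1 (Walk.length_eq_zero_iff.1 hq.1)
      simp [h1, h2]
    · rw [Nat.card_eq_zero]
      left
      exact ⟨fun p => h (Walk.eq_of_length_eq_zero p.2.1)⟩
  | succ n ih =>
    rw [← Nat.card_congr (Equiv.ofBijective _ (stepFun_bij n x y _)), Nat.card_sigma]
    simp only [ih]
    rw [← Finset.sum_subtype (({x + 1, x + 20, x + 6, x + 15} : Finset (ZMod 21)).filter
      (fun w => s(a, a + s) ≠ s(x, w))) (p := fun w => GG.Adj x w ∧ s(a, a + s) ≠ s(x, w))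
      (by intro w; rw [Finset.mem_filter, gg_adj]) (fun w => cnt s n (w - a) (y - a)),
      Finset.sum_filter]
    have h4 : (x + 1 ≠ x + 20 ∧ x + 1 ≠ x + 6 ∧ x + 1 ≠ x + 15) ∧
      (x + 20 ≠ x + 6 ∧ x + 20 ≠ x + 15) ∧ x + 6 ≠ x + 15 := by
      simp only [ne_eq, add_right_inj]
      decide
    obtain ⟨⟨h1, h2, h3⟩, ⟨h5, h6⟩, h7⟩ := h4
    rw [Finset.sum_insert (by simp only [Finset.mem_insert, Finset.mem_singleton]; tauto),
      Finset.sum_insert (by simp only [Finset.mem_insert, Finset.mem_singleton]; tauto),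
      Finset.sum_insert (by simp only [Finset.mem_singleton]; tauto),
      Finset.sum_singleton]
    have key : ∀ t : ZMod 21, (if s(a, a + s) ≠ s(x, x + t) then cnt s n (x + t - a) (y - a) else 0)
        = if (x - a = 0 ∧ x - a + t = s) ∨ (x - a = s ∧ x - a + t = 0) then 0
          else cnt s n (x - a + t) (y - a) := by
      intro t
      rw [show x + t - a = x - a + t by ring, ite_not]
      refine if_congr ?_ rfl rfl
      rw [Sym2.eq_iff]
      constructor
      · rintro (⟨h, h'⟩ | ⟨h, h'⟩)
        · left; subst h; exact ⟨by ring, by linear_combination -h'⟩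
        · right; exact ⟨by linear_combination -h', by linear_combination -h⟩
      · rintro (⟨h, h'⟩ | ⟨h, h'⟩)
        · left; exact ⟨by linear_combination -h, by linear_combination -h'⟩
        · right; exact ⟨by linear_combination -h', by linear_combination -h⟩
    simp only [key, cnt]

lemma card_all (n : ℕ) (x y : ZMod 21) :
    Nat.card {p : GG.Walk x y // p.length = n} = cnt 0 n 0 (y - x) := by
  have h := card_avoid x 0 n x y
  rw [sub_self] at h
  rw [← h]
  refine Nat.card_congr (Equiv.subtypeEquivRight fun p => ?_)
  simp only [add_zero, iff_self_and]
  intro _ H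
  exact GG.loopless.irrefl _ (p.adj_of_mem_edges H)

lemma card_thru (n : ℕ) (x y : ZMod 21) (e : Sym2 (ZMod 21)) :
    Nat.card {p : GG.Walk x y // p.length = n ∧ e ∈ p.edges} +
    Nat.card {p : GG.Walk x y // p.length = n ∧ e ∉ p.edges} =
    Nat.card {p : GG.Walk x y // p.length = n} := by
  classical
  rw [← Nat.card_sum]
  refine Nat.card_congr ?_
  refine (Equiv.sumCongr (Equiv.subtypeSubtypeEquivSubtypeInter _ _).symm
    (Equiv.subtypeSubtypeEquivSubtypeInter _ (fun p : GG.Walk x y => ¬ e ∈ p.edges)).symm).trans ?_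
  exact Equiv.sumCompl (fun p : {p : GG.Walk x y // p.length = n} => e ∈ p.1.edges)

lemma dd_spec : ∀ z : ZMod 21, cnt 0 (dd z) 0 z ≠ 0 ∧ ∀ m < dd z, cnt 0 m 0 z = 0 := by
  decide +kernel

lemma dist_eq (x y : ZMod 21) : GG.dist x y = dd (y - x) := by
  obtain ⟨h1, h2⟩ := dd_spec (y - x)
  rw [← card_all] at h1
  obtain ⟨⟨p, hp⟩⟩ := (Nat.card_ne_zero.1 h1).1
  refine le_antisymm (hp ▸ dist_le p) ?_
  by_contra! hlt
  obtain ⟨q, hq⟩ := p.reachable.exists_walk_length_eq_dist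
  have h3 := h2 _ hlt
  rw [← card_all, Nat.card_eq_zero] at h3
  rcases h3 with h3 | h3
  · exact h3.elim ⟨q, hq⟩
  · exact h3.not_finite inferInstance

/-- The explicit summand. -/
def term (s x y : ZMod 21) : ℚ :=
  if x = y then 0 else
    ((cnt 0 (dd (y - x)) 0 (y - x) : ℚ) - cnt s (dd (y - x)) x y) / cnt 0 (dd (y - x)) 0 (y - x)

lemma eb_eq (a s : ZMod 21) :
    edgeBetweenness GG s(a, a + s) = ∑ x : ZMod 21, ∑ y : ZMod 21, term s x y := by
  have h : ∀ x y : ZMod 21, (if x = y then (0 : ℚ) else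
      (numShortestPathsThru GG x y s(a, a + s) : ℚ) / (numShortestPaths GG x y)) =
      term s (x - a) (y - a) := by
    intro x y
    unfold term numShortestPaths numShortestPathsThru
    rw [dist_eq, sub_sub_sub_cancel_right]
    simp only [sub_left_inj]
    rw [← card_avoid, ← card_all, ← card_thru _ _ _ s(a, a + s)]
    push_cast
    simp
  unfold edgeBetweenness
  rw [← Equiv.sum_comp (Equiv.subRight a) (fun x => ∑ y : ZMod 21, term s x y)]
  refine Finset.sum_congr rfl fun x _ => ?_
  rw [← Equiv.sum_comp (Equiv.subRight a) (fun y => term s _ y)]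
  refine Finset.sum_congr rfl fun y _ => ?_
  simp only [Equiv.subRight_apply]
  rw [← h]
  congr

lemma val1 : ∑ x : ZMod 21, ∑ y : ZMod 21, term 1 x y = 22 := by decide +kernel

lemma val6 : ∑ x : ZMod 21, ∑ y : ZMod 21, term 6 x y = 22 := by decide +kernel

lemma main_eq (e : Sym2 (ZMod 21)) (he : e ∈ GG.edgeSet) : edgeBetweenness GG e = 22 := by
  induction e with | _ x w
  rw [mem_edgeSet, gg_adj] at he
  simp only [Finset.mem_insert, Finset.mem_singleton] at he
  rcases he with rfl | rfl | rfl | rfl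
  · rw [eb_eq, val1]
  · have : x = x + 20 + 1 := by rw [add_assoc, show (20 + 1 : ZMod 21) = 0 by decide, add_zero]
    rw [Sym2.eq_swap]
    nth_rw 2 [this]
    rw [eb_eq, val1]
  · rw [eb_eq, val6]
  · have : x = x + 15 + 6 := by rw [add_assoc, show (15 + 6 : ZMod 21) = 0 by decide, add_zero]
    rw [Sym2.eq_swap]
    nth_rw 2 [this]
    rw [eb_eq, val6]

theorem stmt17 :
    (∀ e ∈ (circulantGraph ({1, -1, 6, -6} : Set (ZMod 21))).edgeSet,
      edgeBetweenness (circulantGraph ({1, -1, 6, -6} : Set (ZMod 21))) e = 22) ∧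
    (∀ e₁ ∈ (circulantGraph ({1, -1, 6, -6} : Set (ZMod 21))).edgeSet,
     ∀ e₂ ∈ (circulantGraph ({1, -1, 6, -6} : Set (ZMod 21))).edgeSet,
      edgeBetweenness (circulantGraph ({1, -1, 6, -6} : Set (ZMod 21))) e₁ =
        edgeBetweenness (circulantGraph ({1, -1, 6, -6} : Set (ZMod 21))) e₂) := by
  exact ⟨main_eq, fun e₁ h₁ e₂ h₂ => (main_eq e₁ h₁).trans (main_eq e₂ h₂).symm⟩
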